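/- arXiv:2305.08795 — 5 statements merged into one kernel-verified Lean document; each statement's English description precedes it below -/
import Mathlib

section
/- Let V₁ and V₂ be representations of G, and let h ∈ G be such that U ∩ hUh⁻¹ and U ∩ h⁻¹Uh both have finite index in U. Then 𝒥 maps Hom_U(V₁, ind_U^{UhU}(V₂)) bijectively onto Hom_U(V₁, ind_U^{Uh⁻¹U}(V₂)), where both are viewed as subspaces of Hom_U(V₁, Ind_U^G(V₂)). -/
/-- The transformation rule of functions in `Ind_U^G(V)`:
`f (g * u) = u⁻¹ • f g` for all `g ∈ G` and `u ∈ U`. -/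
def IsInd {G V : Type*} [Group G] (U : Subgroup G) [SMul G V] (f : G → V) : Prop :=
  ∀ g : G, ∀ u ∈ U, f (g * u) = u⁻¹ • f g

/-- `α : V₁ → (G → V₂)` is a `U`-equivariant `k`-linear map `V₁ → Ind_U^G(V₂)`:
it is `k`-linear, takes values in `Ind_U^G(V₂)`, and is `U`-equivariant for the
`G`-action `(g • f) x = f (g⁻¹ * x)` on the induced representation. -/
def IsIndHom (k : Type*) {G V₁ V₂ : Type*} [Semiring k] [Group G] (U : Subgroup G)
    [AddCommMonoid V₁] [Module k V₁] [SMul G V₁]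
    [AddCommMonoid V₂] [Module k V₂] [SMul G V₂] (α : V₁ → G → V₂) : Prop :=
  (∀ (c : k) (x y : V₁), α (c • x + y) = c • α x + α y) ∧
  (∀ x : V₁, IsInd U (α x)) ∧
  (∀ u ∈ U, ∀ (x : V₁) (g : G), α (u • x) g = α x (u⁻¹ * g))

/-- The map `𝒥`, `𝒥(α) x g = g⁻¹ • (α (g⁻¹ • x) g⁻¹)`. -/
def Jmap {G V₁ V₂ : Type*} [Group G] [SMul G V₁] [SMul G V₂]
    (α : V₁ → G → V₂) : V₁ → G → V₂ :=
  fun x g => g⁻¹ • α (g⁻¹ • x) g⁻¹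

/-- `f : G → V` is supported in finitely many left cosets of `U`. -/
def FinSupp {G V : Type*} [Group G] (U : Subgroup G) [Zero V] (f : G → V) : Prop :=
  ∃ S : Finset G, ∀ g : G, f g ≠ 0 → ∃ s ∈ S, s⁻¹ * g ∈ U

/-- The double coset `UhU`. -/
def DCoset {G : Type*} [Group G] (U : Subgroup G) (h : G) : Set G :=
  {g | ∃ u₁ ∈ U, ∃ u₂ ∈ U, g = u₁ * h * u₂}

/-- `f` has support contained in `X`. -/
def SuppIn {G V : Type*} [Zero V] (X : Set G) (f : G → V) : Prop :=
  ∀ g, f g ≠ 0 → g ∈ X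

/-- The subgroup `U_h = U ∩ hUh⁻¹` of `G`. -/
def Uconj {G : Type*} [Group G] (U : Subgroup G) (h : G) : Subgroup G where
  carrier := {u | u ∈ U ∧ h⁻¹ * u * h ∈ U}
  one_mem' := ⟨U.one_mem, by simpa using U.one_mem⟩
  mul_mem' := by
    intro a b ha hb
    obtain ⟨ha₁, ha₂⟩ := ha
    obtain ⟨hb₁, hb₂⟩ := hb
    refine ⟨U.mul_mem ha₁ hb₁, ?_⟩
    have : h⁻¹ * (a * b) * h = (h⁻¹ * a * h) * (h⁻¹ * b * h) := by group
    rw [this]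
    exact U.mul_mem ha₂ hb₂
  inv_mem' := by
    intro a ha
    obtain ⟨ha₁, ha₂⟩ := ha
    refine ⟨U.inv_mem ha₁, ?_⟩
    have : h⁻¹ * a⁻¹ * h = (h⁻¹ * a * h)⁻¹ := by group
    rw [this]
    exact U.inv_mem ha₂

theorem finSupp_of_suppIn {G V : Type*} [Group G] (U : Subgroup G) [Zero V] (h : G)
    (hfin : (Uconj U h).relIndex U ≠ 0) (f : G → V) (hf : SuppIn (DCoset U h) f) :
    FinSupp U f := by
  classical
  have hfi : ((Uconj U h).subgroupOf U).index ≠ 0 := hfin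
  haveI : ((Uconj U h).subgroupOf U).FiniteIndex := ⟨hfi⟩
  haveI : Fintype (U ⧸ (Uconj U h).subgroupOf U) := Fintype.ofFinite _
  refine ⟨Finset.univ.image
    (fun q : U ⧸ (Uconj U h).subgroupOf U => ((Quotient.out q : U) : G) * h), ?_⟩
  intro g hg
  obtain ⟨u₁, h₁, u₂, h₂, rfl⟩ := hf g hg
  let q : U ⧸ (Uconj U h).subgroupOf U := QuotientGroup.mk (⟨u₁, h₁⟩ : U)
  refine ⟨((Quotient.out q : U) : G) * h, Finset.mem_image_of_mem _ (Finset.mem_univ q), ?_⟩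
  have hq : (Quotient.out q)⁻¹ * (⟨u₁, h₁⟩ : U) ∈ (Uconj U h).subgroupOf U :=
    QuotientGroup.eq.1 (QuotientGroup.out_eq' q)
  rw [Subgroup.mem_subgroupOf] at hq
  have h3 : h⁻¹ * (((Quotient.out q : U) : G)⁻¹ * u₁) * h ∈ U := hq.2
  have := U.mul_mem h3 h₂
  simpa [mul_assoc] using this

theorem jmap_jmap {G V₁ V₂ : Type*} [Group G] [MulAction G V₁] [MulAction G V₂]
    (α : V₁ → G → V₂) : Jmap (Jmap α) = α := by
  funext x g
  simp [Jmap]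

theorem jmap_mapsTo {k G V₁ V₂ : Type*} [Field k] [Group G] (U : Subgroup G)
    [AddCommGroup V₁] [Module k V₁] [DistribMulAction G V₁] [SMulCommClass G k V₁]
    [AddCommGroup V₂] [Module k V₂] [DistribMulAction G V₂] [SMulCommClass G k V₂]
    (h h' : G) (hh : h' = h⁻¹) (hfin : (Uconj U h').relIndex U ≠ 0) :
    Set.MapsTo (Jmap : (V₁ → G → V₂) → (V₁ → G → V₂))
      {α | IsIndHom k U α ∧ ∀ x, FinSupp U (α x) ∧ SuppIn (DCoset U h) (α x)}
      {α | IsIndHom k U α ∧ ∀ x, FinSupp U (α x) ∧ SuppIn (DCoset U h') (α x)} := by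
  rintro α ⟨⟨hlin, hind, heq⟩, hs⟩
  have hsupp : ∀ x, SuppIn (DCoset U h') (Jmap α x) := by
    intro x g hg
    have h1 : α (g⁻¹ • x) g⁻¹ ≠ 0 := by
      intro h0
      exact hg (by simp [Jmap, h0])
    obtain ⟨u₁, h₁, u₂, h₂, e⟩ := (hs _).2 _ h1
    refine ⟨u₂⁻¹, U.inv_mem h₂, u₁⁻¹, U.inv_mem h₁, ?_⟩
    rw [← inv_inv g, e, hh]
    group
  refine ⟨⟨?_, ?_, ?_⟩, fun x => ⟨finSupp_of_suppIn U h' hfin _ (hsupp x), hsupp x⟩⟩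
  · intro c x y
    funext g
    simp only [Jmap, Pi.add_apply, Pi.smul_apply]
    rw [smul_add, smul_comm g⁻¹ c x, hlin, Pi.add_apply, Pi.smul_apply, smul_add,
      smul_comm g⁻¹ c]
  · intro x g u hu
    simp only [Jmap]
    rw [mul_inv_rev, mul_smul u⁻¹ g⁻¹ x, heq _ (U.inv_mem hu), inv_inv,
      mul_inv_cancel_left, mul_smul]
  · intro u hu x g
    simp only [Jmap]
    rw [mul_inv_rev, inv_inv, hind _ _ _ hu, smul_smul g⁻¹ u x, smul_smul (g⁻¹ * u),
      mul_inv_cancel_right]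

/-- If `U ∩ hUh⁻¹` and `U ∩ h⁻¹Uh` have finite index in `U`, then `𝒥` maps
`Hom_U(V₁, ind_U^{UhU}(V₂))` bijectively onto `Hom_U(V₁, ind_U^{Uh⁻¹U}(V₂))`. -/
theorem stmt3 {k G V₁ V₂ : Type*} [Field k] [Group G] (U : Subgroup G)
    [AddCommGroup V₁] [Module k V₁] [DistribMulAction G V₁] [SMulCommClass G k V₁]
    [AddCommGroup V₂] [Module k V₂] [DistribMulAction G V₂] [SMulCommClass G k V₂]
    (h : G)
    (hfin₁ : (Uconj U h).relIndex U ≠ 0) (hfin₂ : (Uconj U h⁻¹).relIndex U ≠ 0) :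
    Set.BijOn (Jmap : (V₁ → G → V₂) → (V₁ → G → V₂))
      {α | IsIndHom k U α ∧ ∀ x, FinSupp U (α x) ∧ SuppIn (DCoset U h) (α x)}
      {α | IsIndHom k U α ∧ ∀ x, FinSupp U (α x) ∧ SuppIn (DCoset U h⁻¹) (α x)} := by
  refine ⟨jmap_mapsTo U h h⁻¹ rfl hfin₂, ?_, ?_⟩
  · intro α _ β _ e
    rw [← jmap_jmap α, e, jmap_jmap]
  · intro β hβ
    exact ⟨Jmap β, jmap_mapsTo U h⁻¹ h (inv_inv h).symm hfin₁ hβ, jmap_jmap β⟩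
end

section
/- Let V₁ and V₂ be representations of G, let h ∈ G, and set U_h := U ∩ hUh⁻¹; assume U_h has finite index in U. Let V₂^h denote the k-vector space V₂ with the U_h-action under which u' ∈ U_h acts as the element h⁻¹u'h of U. Then the Shapiro map Sh_h : Hom_U(V₁, ind_U^{UhU}(V₂)) → Hom_{U_h}(V₁, V₂^h) defined by Sh_h(α)(x) = α(x)(h) is a well-defined k-linear isomorphism. -/
/-- The Shapiro map `Sh_h(α) = (x ↦ α x h)` is a well-defined `k`-linear isomorphism
`Hom_U(V₁, ind_U^{UhU}(V₂)) → Hom_{U_h}(V₁, V₂^h)`, where `u' ∈ U_h` acts on `V₂^h`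
through `h⁻¹ * u' * h ∈ U`. -/
theorem stmt4 {k G V₁ V₂ : Type*} [Field k] [Group G] (U : Subgroup G)
    [AddCommGroup V₁] [Module k V₁] [DistribMulAction G V₁] [SMulCommClass G k V₁]
    [AddCommGroup V₂] [Module k V₂] [DistribMulAction G V₂] [SMulCommClass G k V₂]
    (h : G) (hfin : (Uconj U h).relIndex U ≠ 0) :
    -- well-definedness: `Sh_h(α)` is `k`-linear and `U_h`-equivariant for the twisted
    -- action on `V₂^h`
    (∀ α : V₁ → G → V₂,
      IsIndHom k U α → (∀ x, FinSupp U (α x) ∧ SuppIn (DCoset U h) (α x)) →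
      (∀ (c : k) (x y : V₁), α (c • x + y) h = c • α x h + α y h) ∧
      (∀ u' ∈ Uconj U h, ∀ x : V₁, α (u' • x) h = (h⁻¹ * u' * h) • α x h)) ∧
    -- `Sh_h` is `k`-linear
    (∀ (c : k) (α β : V₁ → G → V₂) (x : V₁),
      (c • α + β) x h = c • α x h + β x h) ∧
    -- `Sh_h` is a bijection onto `Hom_{U_h}(V₁, V₂^h)`
    Set.BijOn (fun (α : V₁ → G → V₂) => fun x : V₁ => α x h)
      {α | IsIndHom k U α ∧ ∀ x, FinSupp U (α x) ∧ SuppIn (DCoset U h) (α x)}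
      {β : V₁ → V₂ | (∀ (c : k) (x y : V₁), β (c • x + y) = c • β x + β y) ∧
        (∀ u' ∈ Uconj U h, ∀ x : V₁, β (u' • x) = (h⁻¹ * u' * h) • β x)} := by
  have key : ∀ α : V₁ → G → V₂, IsIndHom k U α → ∀ u₁ ∈ U, ∀ u₂ ∈ U, ∀ x,
      α x (u₁ * h * u₂) = u₂⁻¹ • α (u₁⁻¹ • x) h := by
    intro α hα u₁ h₁ u₂ h₂ x
    rw [hα.2.1 x (u₁ * h) u₂ h₂, hα.2.2 u₁⁻¹ (U.inv_mem h₁) x h, inv_inv]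
  have wd : ∀ α : V₁ → G → V₂, IsIndHom k U α →
      (∀ (c : k) (x y : V₁), α (c • x + y) h = c • α x h + α y h) ∧
      (∀ u' ∈ Uconj U h, ∀ x : V₁, α (u' • x) h = (h⁻¹ * u' * h) • α x h) := by
    intro α hα
    refine ⟨fun c x y => by rw [hα.1]; rfl, ?_⟩
    intro u' hu x
    obtain ⟨hu1, hu2⟩ := hu
    rw [hα.2.2 u' hu1]
    have e : u'⁻¹ * h = h * (h⁻¹ * u' * h)⁻¹ := by group
    rw [e, hα.2.1 x h _ (U.inv_mem hu2), inv_inv]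
  refine ⟨fun α hα _ => wd α hα, fun c α β x => rfl, fun α hα => wd α hα.1, ?_, ?_⟩
  · intro α hα β hβ hab
    have hab' : ∀ x, α x h = β x h := fun x => congrFun hab x
    funext x g
    by_cases hg : g ∈ DCoset U h
    · obtain ⟨u₁, h₁, u₂, h₂, rfl⟩ := hg
      rw [key α hα.1 u₁ h₁ u₂ h₂, key β hβ.1 u₁ h₁ u₂ h₂, hab']
    · have e1 : α x g = 0 := by
        by_contra hne
        exact hg ((hα.2 x).2 g hne)
      have e2 : β x g = 0 := by
        by_contra hne
        exact hg ((hβ.2 x).2 g hne)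
      rw [e1, e2]
  · rintro β ⟨hlin, heq⟩
    have hex : ∃ A : V₁ → G → V₂,
        (∀ u₁ ∈ U, ∀ u₂ ∈ U, ∀ x, A x (u₁ * h * u₂) = u₂⁻¹ • β (u₁⁻¹ • x)) ∧
        ∀ g, g ∉ DCoset U h → ∀ x, A x g = 0 := by
      have hpt : ∀ g : G, ∃ a : V₁ → V₂,
          (∀ u₁ ∈ U, ∀ u₂ ∈ U, g = u₁ * h * u₂ → ∀ x, a x = u₂⁻¹ • β (u₁⁻¹ • x)) ∧
          (g ∉ DCoset U h → ∀ x, a x = 0) := by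
        intro g
        by_cases hg : g ∈ DCoset U h
        · have hg' := hg
          obtain ⟨u₁, h₁, u₂, h₂, e⟩ := hg'
          refine ⟨fun x => u₂⁻¹ • β (u₁⁻¹ • x), ?_, fun hn => absurd hg hn⟩
          intro v₁ k₁ v₂ k₂ e' x
          have ee : u₁ * h * u₂ = v₁ * h * v₂ := e.symm.trans e'
          have e3 : h⁻¹ * (v₁⁻¹ * u₁) * h = v₂ * u₂⁻¹ := by
            have : u₁ = v₁ * h * v₂ * u₂⁻¹ * h⁻¹ := by rw [← ee]; group
            rw [this]; group
          have hw : v₁⁻¹ * u₁ ∈ Uconj U h :=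
            ⟨U.mul_mem (U.inv_mem k₁) h₁, by
              rw [e3]; exact U.mul_mem k₂ (U.inv_mem h₂)⟩
          have e4 := heq _ hw (u₁⁻¹ • x)
          rw [e3, smul_smul, mul_inv_cancel_right] at e4
          rw [e4, smul_smul, inv_mul_cancel_left]
        · refine ⟨fun _ => 0, ?_, fun _ _ => rfl⟩
          intro u₁ h₁ u₂ h₂ e
          exact absurd ⟨u₁, h₁, u₂, h₂, e⟩ hg
      choose a ha1 ha2 using hpt
      exact ⟨fun x g => a g x, fun u₁ h₁ u₂ h₂ x => ha1 _ u₁ h₁ u₂ h₂ rfl x,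
        fun g hg x => ha2 g hg x⟩
    obtain ⟨A, hA, hA0⟩ := hex
    have hsupp : ∀ x, SuppIn (DCoset U h) (A x) := by
      intro x g hne
      by_contra hg
      exact hne (hA0 g hg x)
    have hmul : ∀ g, ∀ u ∈ U, ∀ v ∈ U, u * g * v ∈ DCoset U h → g ∈ DCoset U h := by
      rintro g u hu v hv ⟨u₁, h₁, u₂, h₂, e⟩
      refine ⟨u⁻¹ * u₁, U.mul_mem (U.inv_mem hu) h₁, u₂ * v⁻¹,
        U.mul_mem h₂ (U.inv_mem hv), ?_⟩
      calc g = u⁻¹ * (u * g * v) * v⁻¹ := by group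
        _ = _ := by rw [e]; group
    refine ⟨A, ⟨⟨?_, ?_, ?_⟩, fun x => ⟨?_, hsupp x⟩⟩, ?_⟩
    · intro c x y
      funext g
      change A (c • x + y) g = c • A x g + A y g
      by_cases hg : g ∈ DCoset U h
      · obtain ⟨u₁, h₁, u₂, h₂, rfl⟩ := hg
        rw [hA u₁ h₁ u₂ h₂, hA u₁ h₁ u₂ h₂, hA u₁ h₁ u₂ h₂, smul_add,
          smul_comm u₁⁻¹ c x, hlin, smul_add, smul_comm u₂⁻¹ c]
      · rw [hA0 g hg, hA0 g hg, hA0 g hg, smul_zero, add_zero]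
    · intro x g u hu
      by_cases hg : g ∈ DCoset U h
      · obtain ⟨u₁, h₁, u₂, h₂, rfl⟩ := hg
        rw [mul_assoc (u₁ * h), hA u₁ h₁ _ (U.mul_mem h₂ hu), hA u₁ h₁ u₂ h₂,
          smul_smul, mul_inv_rev]
      · have hg' : g * u ∉ DCoset U h := fun hc =>
          hg (hmul g 1 U.one_mem u hu (by rwa [one_mul]))
        rw [hA0 g hg, hA0 _ hg', smul_zero]
    · intro u hu x g
      by_cases hg : g ∈ DCoset U h
      · obtain ⟨u₁, h₁, u₂, h₂, rfl⟩ := hg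
        have e : u⁻¹ * (u₁ * h * u₂) = (u⁻¹ * u₁) * h * u₂ := by group
        rw [e, hA _ (U.mul_mem (U.inv_mem hu) h₁) u₂ h₂, hA u₁ h₁ u₂ h₂, smul_smul,
          mul_inv_rev, inv_inv]
      · have hg' : u⁻¹ * g ∉ DCoset U h := fun hc =>
          hg (hmul g u⁻¹ (U.inv_mem hu) 1 U.one_mem (by rwa [mul_one]))
        rw [hA0 g hg, hA0 _ hg']
    · classical
      have : ((Uconj U h).subgroupOf U).FiniteIndex := ⟨hfin⟩
      have : Fintype (U ⧸ (Uconj U h).subgroupOf U) := Fintype.ofFinite _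
      refine ⟨Finset.univ.image
        (fun q : U ⧸ (Uconj U h).subgroupOf U => (q.out : G) * h), ?_⟩
      intro g hne
      obtain ⟨u₁, h₁, u₂, h₂, rfl⟩ := hsupp x g hne
      let q : U ⧸ (Uconj U h).subgroupOf U := QuotientGroup.mk (⟨u₁, h₁⟩ : U)
      refine ⟨(q.out : G) * h, Finset.mem_image_of_mem _ (Finset.mem_univ q), ?_⟩
      have hq : (q.out)⁻¹ * (⟨u₁, h₁⟩ : U) ∈ (Uconj U h).subgroupOf U :=
        QuotientGroup.eq.1 (QuotientGroup.out_eq' q)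
      have hq2 : h⁻¹ * ((q.out : G)⁻¹ * u₁) * h ∈ U := (Subgroup.mem_subgroupOf.1 hq).2
      have e : ((q.out : G) * h)⁻¹ * (u₁ * h * u₂)
          = (h⁻¹ * ((q.out : G)⁻¹ * u₁) * h) * u₂ := by group
      rw [e]
      exact U.mul_mem hq2 h₂
    · funext x
      have := hA 1 U.one_mem 1 U.one_mem x
      simpa using this
end

section
/- Let h ∈ G, set U_h := U ∩ hUh⁻¹ and assume U_h has finite index in U, and let V be a representation of G. Then the map Fr_h : V^{U_h} → Hom_U(ind_U^{UhU}(k), V) given by Fr_h(v)(φ) = Σ_{u ∈ U/U_h} φ(uh)·(u·v) is well defined (the summand depends only on the coset uU_h, and Fr_h(v) is U-equivariant and k-linear) and is a k-linear isomorphism. -/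
/-- `Fr_h(v)(f) = Σ_{u ∈ U/U_h} f(u * h) • (u • v)`, the sum running over
representatives of the left cosets of `U_h = U ∩ hUh⁻¹` in `U`. -/
noncomputable def frMap {k G V : Type*} [Field k] [Group G]
    [AddCommGroup V] [Module k V] [DistribMulAction G V]
    (U : Subgroup G) (h : G) (f : G → k) (v : V) : V :=
  ∑ᶠ q : ↥U ⧸ (Uconj U h).subgroupOf U, f ((q.out : G) * h) • ((q.out : G) • v)

open Classical in
/-- The characteristic function `char_{gU} : G → k` of the left coset `gU`. -/
noncomputable def indLC (k : Type*) {G : Type*} [Field k] [Group G] (U : Subgroup G)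
    (g : G) : G → k :=
  fun x => if x⁻¹ * g ∈ U then 1 else 0

/-- The subspace `ind_U^X(k)` of the compact induction of the trivial representation:
functions `G → k` constant on left cosets of `U`, supported in finitely many of them,
and supported in `X`. -/
def IndK (k : Type*) {G : Type*} [Field k] [Group G] (U : Subgroup G) (X : Set G) :=
  {f : G → k // (∀ g : G, ∀ u ∈ U, f (g * u) = f g) ∧ FinSupp U f ∧ SuppIn X f}

section Helpers

variable {k G V : Type*} [Field k] [Group G] (U : Subgroup G)
    [AddCommGroup V] [Module k V] [DistribMulAction G V] [SMulCommClass G k V] (h : G)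

theorem term_aux (v : V) (hv : ∀ w ∈ Uconj U h, w • v = v) (f : G → k)
    (hf : ∀ g : G, ∀ u ∈ U, f (g * u) = f g) (u u' : G) (hu' : u' ∈ Uconj U h) :
    f (u * u' * h) • ((u * u') • v) = f (u * h) • (u • v) := by
  have h1 : u * u' * h = (u * h) * (h⁻¹ * u' * h) := by group
  rw [h1, hf _ _ hu'.2, mul_smul, hv _ hu']

theorem out_mk_aux (u : U) : ∃ w ∈ Uconj U h,
    (((QuotientGroup.mk u : U ⧸ (Uconj U h).subgroupOf U).out : U) : G) = u * w := by
  obtain ⟨w, hw⟩ := QuotientGroup.mk_out_eq_mul ((Uconj U h).subgroupOf U) u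
  refine ⟨(w : U), Subgroup.mem_subgroupOf.1 w.2, ?_⟩
  rw [hw]; rfl

/-- the induced space as a submodule -/
def indSub (k : Type*) {G : Type*} [Field k] [Group G] (U : Subgroup G) (X : Set G) :
    Submodule k (G → k) where
  carrier := {f | (∀ g : G, ∀ u ∈ U, f (g * u) = f g) ∧ FinSupp U f ∧ SuppIn X f}
  zero_mem' := ⟨by simp, ⟨∅, by simp⟩, by intro g; simp⟩
  add_mem' := by
    classical
    rintro a b ⟨ha, ⟨S, hS⟩, ha3⟩ ⟨hb, ⟨T, hT⟩, hb3⟩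
    have key : ∀ g, (a + b) g ≠ 0 → a g ≠ 0 ∨ b g ≠ 0 := by
      intro g hg
      by_contra hc
      push Not at hc
      exact hg (by simp [hc.1, hc.2])
    refine ⟨fun g u hu => by simp [ha g u hu, hb g u hu], ⟨S ∪ T, fun g hg => ?_⟩, fun g hg => ?_⟩
    · rcases key g hg with h1 | h1
      · obtain ⟨s, hs, hs'⟩ := hS g h1
        exact ⟨s, by simp [hs], hs'⟩
      · obtain ⟨s, hs, hs'⟩ := hT g h1
        exact ⟨s, by simp [hs], hs'⟩
    · rcases key g hg with h1 | h1
      · exact ha3 g h1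
      · exact hb3 g h1
  smul_mem' := by
    rintro c a ⟨ha, ⟨S, hS⟩, ha3⟩
    have key : ∀ g, (c • a) g ≠ 0 → a g ≠ 0 := by
      intro g hg hc
      exact hg (by simp [hc])
    exact ⟨fun g u hu => by simp [ha g u hu], ⟨S, fun g hg => hS g (key g hg)⟩,
      fun g hg => ha3 g (key g hg)⟩

theorem indLC_mem (u : G) (hu : u ∈ U) : indLC k U (u * h) ∈ indSub k U (DCoset U h) := by
  classical
  have key : ∀ g, indLC k U (u * h) g ≠ 0 → g⁻¹ * (u * h) ∈ U := by
    intro g hg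
    by_contra hc
    exact hg (by simp [indLC, hc])
  refine ⟨fun g w hw => ?_, ⟨{u * h}, fun g hg => ⟨u * h, by simp, ?_⟩⟩, fun g hg => ?_⟩
  · have : (g * w)⁻¹ * (u * h) = w⁻¹ * (g⁻¹ * (u * h)) := by group
    simp only [indLC, this, Subgroup.mul_mem_cancel_left U (U.inv_mem hw)]
  · have := U.inv_mem (key g hg)
    have h2 : (g⁻¹ * (u * h))⁻¹ = (u * h)⁻¹ * g := by group
    rwa [h2] at this
  · exact ⟨u, hu, _, U.inv_mem (key g hg), by group⟩

theorem mem_iff_aux (u : U) (q : U ⧸ (Uconj U h).subgroupOf U) :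
    ((u : G) * h)⁻¹ * ((q.out : G) * h) ∈ U ↔ q = QuotientGroup.mk u := by
  rw [← QuotientGroup.out_eq' q, eq_comm, QuotientGroup.eq, Subgroup.mem_subgroupOf,
    QuotientGroup.out_eq' q]
  have h1 : ((u : G) * h)⁻¹ * ((q.out : G) * h) = h⁻¹ * ((u⁻¹ * q.out : U) : G) * h := by
    push_cast; group
  rw [h1]
  exact ⟨fun hh => ⟨SetLike.coe_mem _, hh⟩, fun hh => hh.2⟩

theorem frMap_equiv (hfin : (Uconj U h).relIndex U ≠ 0)
    (v : V) (hv : ∀ w ∈ Uconj U h, w • v = v) (u₀ : G) (hu₀ : u₀ ∈ U) (f g : G → k)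
    (hf : ∀ x : G, ∀ u ∈ U, f (x * u) = f x) (hg : ∀ x, g x = f (u₀⁻¹ * x)) :
    frMap U h g v = u₀ • frMap U h f v := by
  haveI : Finite (U ⧸ (Uconj U h).subgroupOf U) := Nat.finite_of_card_ne_zero hfin
  haveI := Fintype.ofFinite (U ⧸ (Uconj U h).subgroupOf U)
  simp only [frMap, finsum_eq_sum_of_fintype, Finset.smul_sum]
  rw [← Equiv.sum_comp (MulAction.toPerm (⟨u₀, hu₀⟩ : U))]
  refine Finset.sum_congr rfl fun q _ => ?_
  have hq : MulAction.toPerm (⟨u₀, hu₀⟩ : U) q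
      = (QuotientGroup.mk ((⟨u₀, hu₀⟩ : U) * q.out) : U ⧸ (Uconj U h).subgroupOf U) := by
    conv_lhs => rw [← QuotientGroup.out_eq' q]
    rfl
  rw [hq]
  obtain ⟨w, hw, hw'⟩ := out_mk_aux U h ((⟨u₀, hu₀⟩ : U) * q.out)
  rw [hw', hg]
  have h1 : u₀⁻¹ * ((((⟨u₀, hu₀⟩ : U) * q.out : U) : G) * w * h) = (q.out : G) * w * h := by
    push_cast; group
  have h2 : (((⟨u₀, hu₀⟩ : U) * q.out : U) : G) * w = u₀ * ((q.out : G) * w) := by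
    push_cast; group
  rw [h1, h2, mul_smul, ← smul_comm u₀, term_aux U h v hv f hf _ _ hw]

theorem frMap_ind (hfin : (Uconj U h).relIndex U ≠ 0)
    (v : V) (hv : ∀ w ∈ Uconj U h, w • v = v) : frMap U h (indLC k U h) v = v := by
  classical
  haveI : Finite (U ⧸ (Uconj U h).subgroupOf U) := Nat.finite_of_card_ne_zero hfin
  haveI := Fintype.ofFinite (U ⧸ (Uconj U h).subgroupOf U)
  simp only [frMap, finsum_eq_sum_of_fintype]
  have key : ∀ q : U ⧸ (Uconj U h).subgroupOf U,
      ((q.out : G) * h)⁻¹ * h ∈ U ↔ q = QuotientGroup.mk 1 := by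
    intro q
    rw [← mem_iff_aux, ← U.inv_mem_iff]
    have : (((q.out : G) * h)⁻¹ * h)⁻¹ = (((1 : U) : G) * h)⁻¹ * (q.out * h) := by
      push_cast; group
    rw [this]
  simp only [indLC, key]
  rw [Finset.sum_eq_single (QuotientGroup.mk 1)]
  · obtain ⟨w, hw, hw'⟩ := out_mk_aux U h 1
    rw [hw', if_pos rfl, one_smul, OneMemClass.coe_one, one_mul, hv w hw]
  · intro q _ hq
    rw [if_neg hq, zero_smul]
  · simp

theorem expand_aux [Fintype (U ⧸ (Uconj U h).subgroupOf U)]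
    (f : G → k) (hf : f ∈ indSub k U (DCoset U h)) :
    f = ∑ q : U ⧸ (Uconj U h).subgroupOf U,
      f ((q.out : G) * h) • indLC k U ((q.out : G) * h) := by
  classical
  funext x
  simp only [Finset.sum_apply, Pi.smul_apply, smul_eq_mul]
  have hx : ∀ y, x⁻¹ * y ∈ U → f y = f x := by
    intro y hy
    rw [← hf.1 x _ hy, mul_inv_cancel_left]
  have h1 : ∀ q : U ⧸ (Uconj U h).subgroupOf U,
      f ((q.out : G) * h) * indLC k U ((q.out : G) * h) x
        = if x⁻¹ * ((q.out : G) * h) ∈ U then f x else 0 := by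
    intro q
    by_cases hc : x⁻¹ * ((q.out : G) * h) ∈ U
    · simp [indLC, hc, hx _ hc]
    · simp [indLC, hc]
  rw [Finset.sum_congr rfl fun q _ => h1 q]
  by_cases h0 : f x = 0
  · simp [h0]
  · obtain ⟨u₁, hu₁, u₂, hu₂, rfl⟩ := hf.2.2 x h0
    have h2 : ∀ q : U ⧸ (Uconj U h).subgroupOf U,
        (u₁ * h * u₂)⁻¹ * ((q.out : G) * h) ∈ U ↔ q = QuotientGroup.mk ⟨u₁, hu₁⟩ := by
      intro q
      rw [← mem_iff_aux, ← Subgroup.mul_mem_cancel_left U hu₂]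
      have : u₂ * ((u₁ * h * u₂)⁻¹ * ((q.out : G) * h)) = (u₁ * h)⁻¹ * (q.out * h) := by group
      rw [this]
    simp only [h2]
    simp

theorem surj_aux (hfin : (Uconj U h).relIndex U ≠ 0) (β : IndK k U (DCoset U h) → V)
    (h1 : ∀ (c : k) (φ ψ ξ : IndK k U (DCoset U h)), ξ.val = c • φ.val + ψ.val →
            β ξ = c • β φ + β ψ)
    (h2 : ∀ u₀ ∈ U, ∀ φ ψ : IndK k U (DCoset U h),
            (∀ x : G, ψ.val x = φ.val (u₀⁻¹ * x)) → β ψ = u₀ • β φ) :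
    ∃ v : V, (∀ w ∈ Uconj U h, w • v = v) ∧
      ∀ φ : IndK k U (DCoset U h), frMap U h φ.val v = β φ := by
  classical
  haveI : Finite (U ⧸ (Uconj U h).subgroupOf U) := Nat.finite_of_card_ne_zero hfin
  haveI := Fintype.ofFinite (U ⧸ (Uconj U h).subgroupOf U)
  let e : U → IndK k U (DCoset U h) := fun u => ⟨indLC k U (u * h), indLC_mem U h u u.2⟩
  have he : ∀ u : U, β (e u) = (u : G) • β (e 1) := by
    intro u
    refine h2 u u.2 _ _ fun x => ?_
    have : ((u : G)⁻¹ * x)⁻¹ * (((1 : U) : G) * h) = x⁻¹ * (u * h) := by push_cast; group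
    simp only [e, indLC, this]
  have hβ0 : β ⟨0, (indSub k U (DCoset U h)).zero_mem⟩ = 0 := by
    have := h1 1 ⟨0, (indSub k U (DCoset U h)).zero_mem⟩ ⟨0, (indSub k U (DCoset U h)).zero_mem⟩
      ⟨0, (indSub k U (DCoset U h)).zero_mem⟩ (by simp)
    simpa using this
  let L : indSub k U (DCoset U h) →ₗ[k] V :=
    { toFun := fun x => β ⟨x.1, x.2⟩
      map_add' := fun x y => by
        have := h1 1 ⟨x.1, x.2⟩ ⟨y.1, y.2⟩ ⟨(x + y).1, (x + y).2⟩ (by simp)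
        simpa using this
      map_smul' := fun c x => by
        have := h1 c ⟨x.1, x.2⟩ ⟨0, (indSub k U (DCoset U h)).zero_mem⟩
          ⟨(c • x).1, (c • x).2⟩ (by simp)
        rw [hβ0, add_zero] at this
        simpa using this }
  refine ⟨β (e 1), fun w hw => ?_, fun φ => ?_⟩
  · refine (h2 w hw.1 _ _ fun x => ?_).symm
    have : (w⁻¹ * x)⁻¹ * (((1 : U) : G) * h)
        = (x⁻¹ * (((1 : U) : G) * h)) * (h⁻¹ * w * h) := by push_cast; group
    simp only [e, indLC, this, Subgroup.mul_mem_cancel_right U hw.2]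
  · simp only [frMap, finsum_eq_sum_of_fintype, ← he]
    have hφ : (⟨φ.1, φ.2⟩ : indSub k U (DCoset U h)) = ∑ q : U ⧸ (Uconj U h).subgroupOf U,
        φ.1 ((q.out : G) * h) •
          (⟨indLC k U ((q.out : G) * h), indLC_mem U h _ q.out.2⟩ :
            indSub k U (DCoset U h)) := by
      apply Subtype.ext
      have := expand_aux U h φ.1 φ.2
      simpa using this
    have h3 := congrArg L hφ
    rw [map_sum] at h3
    simp only [map_smul] at h3
    exact h3.symm

end Helpers

/-- If `U_h = U ∩ hUh⁻¹` has finite index in `U`, then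
`Fr_h : V^{U_h} → Hom_U(ind_U^{UhU}(k), V)`, `Fr_h(v)(φ) = Σ_{u ∈ U/U_h} φ(uh) • (u•v)`,
is well defined and a `k`-linear isomorphism. -/
theorem stmt16 {k G V : Type*} [Field k] [Group G] (U : Subgroup G)
    [AddCommGroup V] [Module k V] [DistribMulAction G V] [SMulCommClass G k V]
    (h : G) (hfin : (Uconj U h).relIndex U ≠ 0) :
    -- the summand depends only on the left coset of `U_h` in `U`
    (∀ v ∈ {v : V | ∀ w ∈ Uconj U h, w • v = v},
      ∀ f : G → k, (∀ g : G, ∀ u ∈ U, f (g * u) = f g) →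
      ∀ u u' : G, u ∈ U → u' ∈ Uconj U h →
        f (u * u' * h) • ((u * u') • v) = f (u * h) • (u • v)) ∧
    -- `Fr_h(v)` is a `k`-linear, `U`-equivariant map `ind_U^{UhU}(k) → V`
    (∀ v ∈ {v : V | ∀ w ∈ Uconj U h, w • v = v},
      (∀ (c : k) (φ ψ ξ : IndK k U (DCoset U h)), ξ.val = c • φ.val + ψ.val →
          frMap U h ξ.val v = c • frMap U h φ.val v + frMap U h ψ.val v) ∧
      (∀ u₀ ∈ U, ∀ φ ψ : IndK k U (DCoset U h),
          (∀ x : G, ψ.val x = φ.val (u₀⁻¹ * x)) →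
          frMap U h ψ.val v = u₀ • frMap U h φ.val v)) ∧
    -- `Fr_h` is `k`-linear
    (∀ (c : k) (v w : V), v ∈ {v : V | ∀ w' ∈ Uconj U h, w' • v = v} →
      w ∈ {v : V | ∀ w' ∈ Uconj U h, w' • v = v} →
      ∀ φ : IndK k U (DCoset U h),
        frMap U h φ.val (c • v + w) = c • frMap U h φ.val v + frMap U h φ.val w) ∧
    -- `Fr_h` is a bijection from `V^{U_h}` onto `Hom_U(ind_U^{UhU}(k), V)`
    Set.BijOn (fun (v : V) (φ : IndK k U (DCoset U h)) => frMap U h φ.val v)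
      {v : V | ∀ w ∈ Uconj U h, w • v = v}
      {β : IndK k U (DCoset U h) → V |
        (∀ (c : k) (φ ψ ξ : IndK k U (DCoset U h)), ξ.val = c • φ.val + ψ.val →
            β ξ = c • β φ + β ψ) ∧
        (∀ u₀ ∈ U, ∀ φ ψ : IndK k U (DCoset U h),
            (∀ x : G, ψ.val x = φ.val (u₀⁻¹ * x)) → β ψ = u₀ • β φ)} := by
  haveI : Finite (U ⧸ (Uconj U h).subgroupOf U) := Nat.finite_of_card_ne_zero hfin
  haveI := Fintype.ofFinite (U ⧸ (Uconj U h).subgroupOf U)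
  have hlin : ∀ (v : V) (c : k) (φ ψ ξ : IndK k U (DCoset U h)), ξ.val = c • φ.val + ψ.val →
          frMap U h ξ.val v = c • frMap U h φ.val v + frMap U h ψ.val v := by
    intro v c φ ψ ξ hξ
    simp only [frMap, finsum_eq_sum_of_fintype, Finset.smul_sum, ← Finset.sum_add_distrib, hξ]
    refine Finset.sum_congr rfl fun q _ => ?_
    simp [add_smul, mul_smul]
  refine ⟨fun v hv f hf u u' _ hu' => term_aux U h v hv f hf u u' hu',
    fun v hv => ⟨hlin v, fun u₀ hu₀ φ ψ hψ =>
      frMap_equiv U h hfin v hv u₀ hu₀ φ.1 ψ.1 φ.2.1 hψ⟩, ?_, ?_, ?_, ?_⟩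
  · intro c v w _ _ φ
    simp only [frMap, finsum_eq_sum_of_fintype, Finset.smul_sum, ← Finset.sum_add_distrib]
    refine Finset.sum_congr rfl fun q _ => ?_
    rw [smul_add, smul_add, smul_comm _ c v, smul_comm _ c]
  · intro v hv
    exact ⟨hlin v, fun u₀ hu₀ φ ψ hψ =>
      frMap_equiv U h hfin v hv u₀ hu₀ φ.1 ψ.1 φ.2.1 hψ⟩
  · intro v hv w hw hvw
    have hm : indLC k U h ∈ indSub k U (DCoset U h) := by
      simpa using indLC_mem (k := k) U h 1 U.one_mem
    have := congrFun hvw ⟨indLC k U h, hm⟩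
    simpa [frMap_ind U h hfin v hv, frMap_ind U h hfin w hw] using this
  · rintro β ⟨h1, h2⟩
    obtain ⟨v, hv, hv'⟩ := surj_aux U h hfin β h1 h2
    exact ⟨v, hv, funext hv'⟩
end

section
/- Let h ∈ G with U ∩ hUh⁻¹ and U ∩ h⁻¹Uh both of finite index in U, let V be a representation of G, and let v ∈ V^{U_h} where U_h := U ∩ hUh⁻¹. Then h⁻¹·v ∈ V^{U_{h⁻¹}} where U_{h⁻¹} := U ∩ h⁻¹Uh, and if F ∈ Hom_U(ind_U^G(k), V) denotes the extension of Fr_h(v) by zero on functions supported outside UhU (using the decomposition ind_U^G(k) = ind_U^{UhU}(k) ⊕ ind_U^{G∖UhU}(k)), then 𝒥'(F)(φ) = Fr_{h⁻¹}(h⁻¹·v)(φ) for every φ ∈ ind_U^{Uh⁻¹U}(k). -/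
open Classical in
/-- `𝒥'` for the compact induction of the trivial representation:
`𝒥'(λ)(φ) = Σ_{g ∈ G/U} g • λ(char_{g⁻¹,U}^{φ g})`, the sum running over representatives
of the left cosets of `U` in `G` (the `U`-action on `k` being trivial, one has
`char_{g⁻¹,U}^{g • φ g} = (x ↦ if x ∈ g⁻¹U then φ g else 0)`). -/
noncomputable def J'mapTriv {k G V : Type*} [Field k] [Group G]
    [AddCommMonoid V] [SMul G V] (U : Subgroup G) (lam : (G → k) → V) (φ : G → k) : V :=
  ∑ᶠ q : G ⧸ U, q.out • lam (fun x => if x⁻¹ * q.out⁻¹ ∈ U then φ q.out else 0)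

/-- Let `v ∈ V^{U_h}`, with `U ∩ hUh⁻¹` and `U ∩ h⁻¹Uh` of finite index in `U`.  Then
`h⁻¹ • v ∈ V^{U_{h⁻¹}}`, and for `F ∈ Hom_U(ind_U^G(k), V)` the extension of `Fr_h(v)`
by zero (which evaluates as `f ↦ Fr_h(v)` applied to `f`, since the defining sum only
samples `f` on `UhU`) one has `𝒥'(F)(φ) = Fr_{h⁻¹}(h⁻¹ • v)(φ)` for every
`φ ∈ ind_U^{Uh⁻¹U}(k)`. -/
theorem stmt17 {k G V : Type*} [Field k] [Group G] (U : Subgroup G)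
    [AddCommGroup V] [Module k V] [DistribMulAction G V] [SMulCommClass G k V]
    (h : G)
    (hfin₁ : (Uconj U h).relIndex U ≠ 0) (hfin₂ : (Uconj U h⁻¹).relIndex U ≠ 0)
    (v : V) (hv : ∀ w ∈ Uconj U h, w • v = v) :
    -- `h⁻¹ • v` is fixed by `U_{h⁻¹}`
    (∀ w ∈ Uconj U h⁻¹, w • (h⁻¹ • v) = h⁻¹ • v) ∧
    -- `𝒥'(F) = Fr_{h⁻¹}(h⁻¹ • v)` on `ind_U^{Uh⁻¹U}(k)`
    (∀ φ : G → k, (∀ g : G, ∀ u ∈ U, φ (g * u) = φ g) → FinSupp U φ →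
      SuppIn (DCoset U h⁻¹) φ →
      J'mapTriv U (fun f => frMap U h f v) φ = frMap U h⁻¹ φ (h⁻¹ • v)) := by
  classical
  have key : ∀ x ∈ Uconj U h, x • v = v := hv
  refine ⟨?_, ?_⟩
  · intro w hw
    obtain ⟨hw1, hw2⟩ := hw
    have h1 : h * w * h⁻¹ ∈ Uconj U h := by
      refine ⟨by simpa using hw2, ?_⟩
      have : h⁻¹ * (h * w * h⁻¹) * h = w := by group
      rw [this]; exact hw1
    have h2 := hv _ h1
    calc w • h⁻¹ • v = h⁻¹ • ((h * w * h⁻¹) • v) := by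
          simp only [smul_smul]; congr 1; group
      _ = h⁻¹ • v := by rw [h2]
  · intro φ hφ _ hsupp
    let T : G ⧸ U → V := fun q => q.out • frMap U h
      (fun x => if x⁻¹ * q.out⁻¹ ∈ U then φ q.out else 0) v
    let e : (↥U ⧸ (Uconj U h⁻¹).subgroupOf U) → G ⧸ U :=
      fun p => (((p.out : G) * h⁻¹ : G) : G ⧸ U)
    have he : Function.Injective e := by
      intro p p' hpp
      have h1 := QuotientGroup.eq.1 hpp
      rw [← p.out_eq', ← p'.out_eq']
      refine QuotientGroup.eq.2 ?_
      rw [Subgroup.mem_subgroupOf]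
      refine ⟨((p.out)⁻¹ * p'.out).2, ?_⟩
      have : h⁻¹⁻¹ * (((p.out)⁻¹ * p'.out : U) : G) * h⁻¹
          = ((p.out : G) * h⁻¹)⁻¹ * ((p'.out : G) * h⁻¹) := by
        push_cast; group
      rw [this]; exact h1
    have hTe : ∀ p, T (e p) = φ ((p.out : G) * h⁻¹) • ((p.out : G) • (h⁻¹ • v)) := by
      intro p
      obtain ⟨u, hu⟩ := QuotientGroup.mk_out_eq_mul U ((p.out : G) * h⁻¹)
      have hg : (e p).out = (p.out : G) * h⁻¹ * u := hu
      have hcond : ∀ y : U, (((y : G) * h)⁻¹ * ((e p).out)⁻¹ ∈ U) ↔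
          u * y ∈ (Uconj U h).subgroupOf U := by
        intro y
        rw [hg, Subgroup.mem_subgroupOf, ← U.inv_mem_iff]
        have : (((y : G) * h)⁻¹ * ((p.out : G) * h⁻¹ * u)⁻¹)⁻¹
          = (p.out : G) * (h⁻¹ * ((u * y : U) : G) * h) := by push_cast; group
        rw [this, U.mul_mem_cancel_left p.out.2]
        exact ⟨fun hh => ⟨(u * y).2, hh⟩, fun hh => hh.2⟩
      have hφg : φ (e p).out = φ ((p.out : G) * h⁻¹) := by
        rw [hg]; exact hφ _ _ u.2
      simp only [T, frMap]
      rw [finsum_eq_single _ ((u⁻¹ : U) : ↥U ⧸ (Uconj U h).subgroupOf U)]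
      · obtain ⟨x, hx⟩ := QuotientGroup.mk_out_eq_mul ((Uconj U h).subgroupOf U) u⁻¹
        rw [hx, if_pos, hφg, smul_comm]
        · congr 1
          have hxv : ((x : U) : G) • v = v := hv _ (Subgroup.mem_subgroupOf.1 x.2)
          rw [hg]
          push_cast
          rw [mul_smul ((u : G)⁻¹), hxv]
          simp only [smul_smul]
          congr 1; group
        · rw [hcond]
          simp
      · intro q hq
        rw [if_neg, zero_smul]
        rw [hcond]
        intro hc
        apply hq
        rw [← q.out_eq']
        symm
        refine QuotientGroup.eq.2 ?_
        simpa using hc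
    have hT0 : ∀ q, q ∉ Set.range e → T q = 0 := by
      intro q hq
      have h0 : φ q.out = 0 := by
        by_contra hne
        obtain ⟨a, ha, b, hb, hab⟩ := hsupp _ hne
        apply hq
        refine ⟨((⟨a, ha⟩ : U) : ↥U ⧸ (Uconj U h⁻¹).subgroupOf U), ?_⟩
        obtain ⟨x, hx⟩ := QuotientGroup.mk_out_eq_mul ((Uconj U h⁻¹).subgroupOf U) ⟨a, ha⟩
        rw [← q.out_eq']
        simp only [e]
        refine QuotientGroup.eq.2 ?_
        rw [hx, hab]
        have hx2 := (Subgroup.mem_subgroupOf.1 x.2).2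
        have : (((⟨a, ha⟩ * (x : U) : U) : G) * h⁻¹)⁻¹ * (a * h⁻¹ * b)
          = (h⁻¹⁻¹ * ((x : U) : G) * h⁻¹)⁻¹ * b := by push_cast; group
        rw [this]
        exact U.mul_mem (U.inv_mem hx2) hb
      simp [T, frMap, h0]
    calc J'mapTriv U (fun f => frMap U h f v) φ = ∑ᶠ q, T q := by
          simp only [J'mapTriv, T]
      _ = ∑ᶠ q ∈ Set.range e, T q := by
          refine finsum_congr fun q => ?_
          by_cases hq : q ∈ Set.range e
          · rw [finsum_eq_if, if_pos hq]
          · rw [finsum_eq_if, if_neg hq, hT0 q hq]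
      _ = ∑ᶠ p, T (e p) := finsum_mem_range he
      _ = frMap U h⁻¹ φ (h⁻¹ • v) := by
          simp only [frMap]
          exact finsum_congr hTe
end

section
/- Let h ∈ G, set U_h := U ∩ hUh⁻¹ and assume U_h has finite index in U, let V be a representation of G and v ∈ V^{U_h}. Let F ∈ Hom_U(ind_U^G(k), V) be the extension of Fr_h(v) by zero on functions supported outside UhU. Then in the sum Σ_{g ∈ G/U} F(char_{gU}) (over representatives of the left cosets of U, where char_{gU} is the characteristic function of gU) only finitely many terms are nonzero, and Σ_{g ∈ G/U} F(char_{gU}) = Σ_{u ∈ U/U_h} u·v; that is, Tr(F) sends 1 ∈ k to the transfer (corestriction) Σ_{u ∈ U/U_h} u·v of v. -/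
/-- Let `U_h = U ∩ hUh⁻¹` be of finite index in `U` and `v ∈ V^{U_h}`, and let `F` be
the extension by zero of `Fr_h(v)` to `ind_U^G(k)` (which evaluates as
`f ↦ Fr_h(v)(f)`, since the defining sum only samples `f` on `UhU`).  Then in the sum
`Σ_{g ∈ G/U} F(char_{gU})` only finitely many terms are nonzero, and
`Σ_{g ∈ G/U} F(char_{gU}) = Σ_{u ∈ U/U_h} u • v`; that is, `Tr(F)` sends `1 ∈ k` to the
transfer (corestriction) of `v`. -/
theorem stmt18 {k G V : Type*} [Field k] [Group G] (U : Subgroup G)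
    [AddCommGroup V] [Module k V] [DistribMulAction G V] [SMulCommClass G k V]
    (h : G) (hfin : (Uconj U h).relIndex U ≠ 0)
    (v : V) (hv : ∀ w ∈ Uconj U h, w • v = v) :
    -- only finitely many cosets contribute
    (Function.support fun q : G ⧸ U => frMap U h (indLC k U q.out) v).Finite ∧
    -- `Σ_{g ∈ G/U} F(char_{gU}) = Σ_{u ∈ U/U_h} u • v`
    ∑ᶠ q : G ⧸ U, frMap U h (indLC k U q.out) v
      = ∑ᶠ r : ↥U ⧸ (Uconj U h).subgroupOf U, ((r.out : G) • v) := by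
  classical
  have hfi : Finite (↥U ⧸ (Uconj U h).subgroupOf U) := by
    have : ((Uconj U h).subgroupOf U).FiniteIndex := ⟨hfin⟩
    infer_instance
  have : Fintype (↥U ⧸ (Uconj U h).subgroupOf U) := Fintype.ofFinite _
  let c : (↥U ⧸ (Uconj U h).subgroupOf U) → G ⧸ U := fun r => ((r.out : G) * h : G)
  have key : ∀ q : G ⧸ U, frMap U h (indLC k U q.out) v
      = ∑ r : ↥U ⧸ (Uconj U h).subgroupOf U, if c r = q then (r.out : G) • v else 0 := by
    intro q
    unfold frMap
    rw [finsum_eq_sum_of_fintype]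
    refine Finset.sum_congr rfl fun r _ => ?_
    have e : (((r.out : G) * h)⁻¹ * q.out ∈ U) ↔ c r = q := by
      rw [← QuotientGroup.eq, QuotientGroup.out_eq']
    unfold indLC
    by_cases hc : c r = q
    · rw [if_pos (e.2 hc), if_pos hc, one_smul]
    · rw [if_neg (fun hh => hc (e.1 hh)), if_neg hc, zero_smul]
  have hsub : (Function.support fun q : G ⧸ U => frMap U h (indLC k U q.out) v)
      ⊆ (Finset.univ.image c : Finset (G ⧸ U)) := by
    intro q hq
    rw [Function.mem_support, key] at hq
    obtain ⟨r, -, hr⟩ := Finset.exists_ne_zero_of_sum_ne_zero hq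
    have : c r = q := by
      by_contra hc
      exact hr (if_neg hc)
    simpa using ⟨r, this⟩
  refine ⟨(Finset.finite_toSet _).subset hsub, ?_⟩
  rw [finsum_eq_sum_of_support_subset _ hsub, finsum_eq_sum_of_fintype]
  simp_rw [key]
  rw [Finset.sum_comm]
  refine Finset.sum_congr rfl fun r _ => ?_
  rw [Finset.sum_ite_eq, if_pos (Finset.mem_image_of_mem c (Finset.mem_univ r))]
end
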